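/- arXiv:0905.1388 — 7 statements merged into one kernel-verified Lean document; each statement's English description precedes it below -/
import Mathlib

section
/- For every real α > −1, the Fermi function f_α : ℝ → ℝ, f_α(z) = ∫₀^∞ x^α/(1 + e^(x−z)) dx, is well defined (the integral converges for every z ∈ ℝ), continuous, strictly increasing, and satisfies f_α(z) > 0 for all z, f_α(z) → 0 as z → −∞, and f_α(z) → ∞ as z → +∞; in particular f_α is a bijection from ℝ onto (0,∞). -/
open Set MeasureTheory Filter Real

/-- The Fermi function of order `α`. -/
noncomputable def fermi (α z : ℝ) : ℝ :=
  ∫ x in Set.Ioi (0:ℝ), x ^ α / (1 + Real.exp (x - z))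

lemma fermi_aux_pos {g : ℝ → ℝ} (hi : IntegrableOn g (Ioi 0)) (hg : ∀ x ∈ Ioi (0:ℝ), 0 < g x) :
    0 < ∫ x in Ioi (0:ℝ), g x := by
  rw [setIntegral_pos_iff_support_of_nonneg_ae]
  · have : Function.support g ∩ Ioi 0 = Ioi 0 :=
      inter_eq_right.2 fun x hx => (hg x hx).ne'
    rw [this, volume_Ioi]
    exact ENNReal.zero_lt_top
  · exact (ae_restrict_mem measurableSet_Ioi).mono fun x hx => (hg x hx).le
  · exact hi

lemma fermi_aux_lt (α : ℝ) {z w x : ℝ} (h : z < w) (hx : 0 < x) :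
    x ^ α / (1 + Real.exp (x - z)) < x ^ α / (1 + Real.exp (x - w)) := by
  have := rpow_pos_of_pos hx α
  have := Real.exp_pos (x - w)
  have : Real.exp (x - w) < Real.exp (x - z) := Real.exp_lt_exp.2 (by linarith)
  gcongr

lemma fermi_aux_posi (α : ℝ) {z x : ℝ} (hx : 0 < x) :
    0 < x ^ α / (1 + Real.exp (x - z)) := by
  have := rpow_pos_of_pos hx α
  positivity

lemma fermi_aux_bound (α : ℝ) {z x : ℝ} (hx : 0 < x) :
    x ^ α / (1 + Real.exp (x - z)) ≤ Real.exp z * (Real.exp (-x) * x ^ ((α + 1) - 1)) := by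
  have := rpow_pos_of_pos hx α
  have h : Real.exp z * Real.exp (-x) * Real.exp (x - z) = 1 := by
    rw [← Real.exp_add, ← Real.exp_add, Real.exp_eq_one_iff]; ring
  have h2 : 0 < Real.exp z * Real.exp (-x) := by positivity
  rw [add_sub_cancel_right, div_le_iff₀ (by positivity)]
  have : Real.exp z * (Real.exp (-x) * x ^ α) * (1 + Real.exp (x - z))
      = x ^ α * (Real.exp z * Real.exp (-x)) +
        x ^ α * (Real.exp z * Real.exp (-x) * Real.exp (x - z)) := by ring
  rw [this, h]
  nlinarith [mul_pos (rpow_pos_of_pos hx α) h2]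

lemma fermi_aux_meas (α z : ℝ) : AEStronglyMeasurable
    (fun x : ℝ => x ^ α / (1 + Real.exp (x - z))) (volume.restrict (Ioi 0)) := by
  apply Measurable.aestronglyMeasurable
  fun_prop

lemma fermi_aux_int (α : ℝ) (hα : -1 < α) (z : ℝ) :
    IntegrableOn (fun x : ℝ => x ^ α / (1 + Real.exp (x - z))) (Ioi 0) := by
  have hG : IntegrableOn (fun x : ℝ => Real.exp z * (Real.exp (-x) * x ^ ((α + 1) - 1))) (Ioi 0) :=
    (Real.GammaIntegral_convergent (s := α + 1) (by linarith)).const_mul _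
  refine Integrable.mono' hG (fermi_aux_meas α z) ?_
  refine (ae_restrict_mem measurableSet_Ioi).mono fun x hx => ?_
  rw [Real.norm_of_nonneg (fermi_aux_posi α hx).le]
  exact fermi_aux_bound α hx

lemma fermi_aux_lower (α : ℝ) (hα : -1 < α) {z : ℝ} (hz : 0 < z) :
    z ^ (α + 1) / (α + 1) / 2 ≤ fermi α z := by
  have h1 : ∫ x in Ioc (0:ℝ) z, x ^ α / 2 = z ^ (α + 1) / (α + 1) / 2 := by
    rw [← intervalIntegral.integral_of_le hz.le, intervalIntegral.integral_div,
      integral_rpow (Or.inl hα), Real.zero_rpow (by linarith), sub_zero]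
  have hi : IntegrableOn (fun x : ℝ => x ^ α / 2) (Ioc 0 z) := by
    rw [← intervalIntegrable_iff_integrableOn_Ioc_of_le hz.le]
    exact (intervalIntegral.intervalIntegrable_rpow' hα).div_const 2
  have hf := fermi_aux_int α hα z
  rw [← h1]
  calc _ ≤ ∫ x in Ioc (0:ℝ) z, x ^ α / (1 + Real.exp (x - z)) := by
        refine setIntegral_mono_on hi (hf.mono_set Ioc_subset_Ioi_self) measurableSet_Ioc ?_
        intro x hx
        have := rpow_pos_of_pos hx.1 α
        have : Real.exp (x - z) ≤ 1 := Real.exp_le_one_iff.2 (by linarith [hx.2])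
        gcongr
        linarith
    _ ≤ _ := by
        refine setIntegral_mono_set hf ?_ (Eventually.of_forall Ioc_subset_Ioi_self)
        exact (ae_restrict_mem measurableSet_Ioi).mono fun x hx => (fermi_aux_posi α hx).le

theorem fermi_well_defined (α : ℝ) (hα : -1 < α) :
    (∀ z : ℝ, IntegrableOn (fun x : ℝ => x ^ α / (1 + Real.exp (x - z))) (Ioi 0)) ∧
    Continuous (fermi α) ∧
    StrictMono (fermi α) ∧
    (∀ z : ℝ, 0 < fermi α z) ∧
    Tendsto (fermi α) atBot (nhds 0) ∧
    Tendsto (fermi α) atTop atTop ∧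
    Set.BijOn (fermi α) Set.univ (Set.Ioi 0) := by
  have hint := fermi_aux_int α hα
  have hcont : Continuous (fermi α) := by
    rw [continuous_iff_continuousAt]
    intro z
    unfold fermi
    refine continuousAt_of_dominated (Eventually.of_forall fun w => fermi_aux_meas α w) ?_
      (hint (z + 1)) ?_
    · filter_upwards [Iio_mem_nhds (show z < z + 1 by linarith)] with w hw
      refine (ae_restrict_mem measurableSet_Ioi).mono fun x hx => ?_
      rw [Real.norm_of_nonneg (fermi_aux_posi α hx).le]
      exact (fermi_aux_lt α hw hx).le
    · refine Eventually.of_forall fun x => Continuous.continuousAt ?_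
      refine Continuous.div (by fun_prop) (by fun_prop) fun w => ?_
      positivity
  have hmono : StrictMono (fermi α) := by
    intro z w h
    have := fermi_aux_pos ((hint w).sub (hint z))
      fun x hx => sub_pos.2 (fermi_aux_lt α h hx)
    simp only [Pi.sub_apply] at this
    rw [integral_sub (hint w) (hint z)] at this
    exact sub_pos.1 this
  have hpos : ∀ z, 0 < fermi α z := fun z =>
    fermi_aux_pos (hint z) fun x hx => fermi_aux_posi α hx
  have hbot : Tendsto (fermi α) atBot (nhds 0) := by
    have hG := Real.GammaIntegral_convergent (s := α + 1) (by linarith)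
    have ht : Tendsto (fun z => Real.exp z * ∫ x in Ioi (0:ℝ), Real.exp (-x) * x ^ ((α + 1) - 1))
        atBot (nhds 0) := by
      simpa using Real.tendsto_exp_atBot.mul_const
        (∫ x in Ioi (0:ℝ), Real.exp (-x) * x ^ ((α + 1) - 1))
    refine squeeze_zero (fun z => (hpos z).le) (fun z => ?_) ht
    rw [← integral_const_mul]
    exact setIntegral_mono_on (hint z) (hG.const_mul _) measurableSet_Ioi
      fun x hx => fermi_aux_bound α hx
  have htop : Tendsto (fermi α) atTop atTop := by
    have h0 : 0 < α + 1 := by linarith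
    refine tendsto_atTop_mono' _ ?_
      (((tendsto_rpow_atTop h0).atTop_div_const h0).atTop_div_const (two_pos))
    filter_upwards [eventually_gt_atTop 0] with z hz
    exact fermi_aux_lower α hα hz
  refine ⟨hint, hcont, hmono, hpos, hbot, htop, fun z _ => hpos z, hmono.injective.injOn, ?_⟩
  intro y hy
  obtain ⟨a, ha⟩ := (hbot.eventually (Iio_mem_nhds hy)).exists
  obtain ⟨b, hb⟩ := (htop.eventually (eventually_gt_atTop y)).exists
  obtain ⟨c, hc⟩ := mem_range_of_exists_le_of_exists_ge hcont ⟨a, le_of_lt ha⟩ ⟨b, hb.le⟩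
  exact ⟨c, mem_univ c, hc⟩
end

section
/- For every real α > 0 and every z ∈ ℝ, the Fermi function f_α is differentiable at z with derivative f_α'(z) = α·f_{α−1}(z). -/
open Set MeasureTheory

theorem fermi_aux_le (x z : ℝ) : (1 + Real.exp (x - z))⁻¹ ≤ Real.exp z * Real.exp (-x) := by
  rw [← Real.exp_add, show z + -x = -(x - z) by ring, Real.exp_neg]
  exact inv_anti₀ (Real.exp_pos _) (by linarith)

theorem fermi_aux_le2 (x z : ℝ) :
    Real.exp (x - z) / (1 + Real.exp (x - z)) ^ 2 ≤ Real.exp z * Real.exp (-x) := by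
  refine le_trans ?_ (fermi_aux_le x z)
  have := Real.exp_pos (x - z)
  rw [div_le_iff₀ (by positivity), pow_two, ← mul_assoc, inv_mul_cancel₀ (by positivity)]
  linarith

theorem fermi_aux_meas_s5 (β : ℝ) (g : ℝ → ℝ) (hg : Continuous g) :
    AEStronglyMeasurable (fun x => x ^ β * g x) (volume.restrict (Ioi (0:ℝ))) := by
  refine ContinuousOn.aestronglyMeasurable ?_ measurableSet_Ioi
  refine ContinuousOn.mul ?_ hg.continuousOn
  intro x hx
  exact (Real.continuousAt_rpow_const x β (Or.inl (ne_of_gt hx))).continuousWithinAt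

theorem fermi_aux_bound_s5 (β c : ℝ) (hβ : -1 < β) :
    IntegrableOn (fun x => x ^ β * (c * Real.exp (-x))) (Ioi (0:ℝ)) := by
  have h := (Real.GammaIntegral_convergent (s := β + 1) (by linarith)).const_mul c
  refine h.congr (Filter.Eventually.of_forall fun x => ?_)
  simp only [add_sub_cancel_right]
  ring

theorem fermi_aux_int_s5 (β c : ℝ) (hβ : -1 < β) (g : ℝ → ℝ) (hg : Continuous g)
    (h0 : ∀ x, 0 ≤ g x) (h : ∀ x, g x ≤ c * Real.exp (-x)) :
    IntegrableOn (fun x => x ^ β * g x) (Ioi (0:ℝ)) := by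
  refine Integrable.mono' (fermi_aux_bound_s5 β c hβ) (fermi_aux_meas_s5 β g hg) ?_
  refine (ae_restrict_mem measurableSet_Ioi).mono fun x hx => ?_
  have hx' : 0 ≤ x ^ β := Real.rpow_nonneg (le_of_lt hx) _
  rw [Real.norm_of_nonneg (mul_nonneg hx' (h0 x))]
  exact mul_le_mul_of_nonneg_left (h x) hx'

theorem fermi_deriv (α : ℝ) (hα : 0 < α) (z : ℝ) :
    HasDerivAt (fermi α) (α * fermi (α - 1) z) z := by
  have hne : ∀ x w : ℝ, 1 + Real.exp (x - w) ≠ 0 := fun x w => by positivity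
  have hc1 : ∀ w : ℝ, Continuous fun x : ℝ => (1 + Real.exp (x - w))⁻¹ := fun w =>
    Continuous.inv₀ (by fun_prop) (fun x => hne x w)
  have hc2 : ∀ w : ℝ, Continuous fun x : ℝ => Real.exp (x - w) / (1 + Real.exp (x - w)) ^ 2 :=
    fun w => Continuous.div (by fun_prop) (by fun_prop) (fun x => pow_ne_zero 2 (hne x w))
  have key := hasDerivAt_integral_of_dominated_loc_of_deriv_le
    (μ := volume.restrict (Ioi (0:ℝ))) (x₀ := z) (s := Iio (z + 1))
    (F := fun w x => x ^ α * (1 + Real.exp (x - w))⁻¹)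
    (F' := fun w x => x ^ α * (Real.exp (x - w) / (1 + Real.exp (x - w)) ^ 2))
    (bound := fun x => x ^ α * (Real.exp (z + 1) * Real.exp (-x)))
    (Iio_mem_nhds (by linarith))
    (Filter.Eventually.of_forall fun w => fermi_aux_meas_s5 α _ (hc1 w))
    (fermi_aux_int_s5 α (Real.exp z) (by linarith) _ (hc1 z) (fun x => by positivity)
      (fun x => fermi_aux_le x z))
    (fermi_aux_meas_s5 α _ (hc2 z))
    (by
      refine (ae_restrict_mem measurableSet_Ioi).mono fun x hx w hw => ?_
      have hx' : 0 ≤ x ^ α := Real.rpow_nonneg (le_of_lt hx) _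
      rw [Real.norm_of_nonneg (by positivity)]
      refine mul_le_mul_of_nonneg_left ((fermi_aux_le2 x w).trans ?_) hx'
      have : Real.exp w ≤ Real.exp (z + 1) := Real.exp_le_exp.2 (le_of_lt hw)
      gcongr)
    (fermi_aux_bound_s5 α _ (by linarith))
    (by
      refine Filter.Eventually.of_forall fun x w _ => ?_
      have h1 : HasDerivAt (fun w => 1 + Real.exp (x - w)) (-Real.exp (x - w)) w := by
        simpa using (((hasDerivAt_id w).const_sub x).exp).const_add 1
      have h2 := (h1.inv (hne x w)).const_mul (x ^ α)
      simpa using h2)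
  have ibp := integral_Ioi_mul_deriv_eq_deriv_mul (a := (0:ℝ)) (a' := (0:ℝ)) (b' := (0:ℝ))
    (u := fun x : ℝ => x ^ α) (u' := fun x => α * x ^ (α - 1))
    (v := fun x => -(1 + Real.exp (x - z))⁻¹)
    (v' := fun x => Real.exp (x - z) / (1 + Real.exp (x - z)) ^ 2)
    (fun x hx => Real.hasDerivAt_rpow_const (Or.inl (ne_of_gt hx)))
    (fun x _ => by
      have h1 : HasDerivAt (fun x => 1 + Real.exp (x - z)) (Real.exp (x - z)) x := by
        simpa using (((hasDerivAt_id x).sub_const z).exp).const_add 1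
      have h2 := (h1.inv (hne x z)).neg
      have e : -(-Real.exp (x - z) / (1 + Real.exp (x - z)) ^ 2)
          = Real.exp (x - z) / (1 + Real.exp (x - z)) ^ 2 := by rw [neg_div, neg_neg]
      rw [e] at h2
      exact h2)
    key.1
    (by
      have h := (fermi_aux_int_s5 (α - 1) (Real.exp z) (by linarith) _ (hc1 z)
        (fun x => by positivity) (fun x => fermi_aux_le x z)).const_mul (-α)
      refine h.congr (Filter.Eventually.of_forall fun x => ?_)
      simp only [Pi.mul_apply]
      ring)
    (by
      have h : Continuous fun x : ℝ => x ^ α * -(1 + Real.exp (x - z))⁻¹ :=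
        (Real.continuous_rpow_const hα.le).mul (hc1 z).neg
      have := (h.tendsto 0).mono_left (nhdsWithin_le_nhds (s := Ioi 0))
      rw [Real.zero_rpow hα.ne', zero_mul] at this
      exact this)
    (by
      have h := (tendsto_rpow_mul_exp_neg_mul_atTop_nhds_zero α 1 one_pos).const_mul (Real.exp z)
      rw [mul_zero] at h
      refine squeeze_zero_norm' ?_ h
      filter_upwards [Filter.eventually_ge_atTop 0] with x hx
      have hx' : 0 ≤ x ^ α := Real.rpow_nonneg hx _
      have h3 := mul_le_mul_of_nonneg_left (fermi_aux_le x z) hx'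
      simp only [Pi.mul_apply, mul_neg, norm_neg]
      rw [Real.norm_of_nonneg (by positivity), neg_one_mul]
      linarith)
  have e1 : fermi α = fun w => ∫ x in Ioi (0:ℝ), x ^ α * (1 + Real.exp (x - w))⁻¹ := by
    funext w
    simp only [fermi, div_eq_mul_inv]
  rw [e1]
  have e2 : α * fermi (α - 1) z
      = ∫ x in Ioi (0:ℝ), x ^ α * (Real.exp (x - z) / (1 + Real.exp (x - z)) ^ 2) := by
    rw [ibp, fermi, ← integral_const_mul, sub_zero, zero_sub, ← integral_neg]
    refine integral_congr_ae (Filter.Eventually.of_forall fun x => ?_)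
    simp only [div_eq_mul_inv]
    ring
  rw [e2]
  exact key.2
end

section
/- For every real α ≥ 0 there exist constants C > 0 and z₀ > 0 such that |f_α(z) − z^(α+1)/(α+1)| ≤ C·z^(α−1) for all z ≥ z₀; that is, f_α(z) − z^(α+1)/(α+1) = O(z^(α−1)) as z → ∞. -/
open Set MeasureTheory

lemma shift_integrable (f : ℝ → ℝ) (c : ℝ) :
    IntegrableOn (fun t => f (t + c)) (Ioi 0) ↔ IntegrableOn f (Ioi c) := by
  have h := (measurePreserving_add_right (volume : Measure ℝ) c).integrableOn_comp_preimage
    (measurableEmbedding_addRight c) (f := f) (s := Ioi c)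
  have e : (fun x : ℝ => x + c) ⁻¹' Ioi c = Ioi 0 := by ext x; simp
  rw [e] at h
  exact h

lemma shift_integral (f : ℝ → ℝ) (c : ℝ) :
    ∫ t in Ioi 0, f (t + c) = ∫ x in Ioi c, f x := by
  have h := (measurePreserving_add_right (volume : Measure ℝ) c).setIntegral_preimage_emb
    (measurableEmbedding_addRight c) f (Ioi c)
  have e : (fun x : ℝ => x + c) ⁻¹' Ioi c = Ioi 0 := by ext x; simp
  rw [e] at h
  exact h

lemma G_integrable (α : ℝ) (hα : 0 ≤ α) :
    IntegrableOn (fun t : ℝ => (t + 1) ^ (α + 1) * Real.exp (-t)) (Ioi 0) := by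
  have h := Real.GammaIntegral_convergent (s := α + 2) (by linarith)
  have h1 := h.mono_set (Ioi_subset_Ioi (zero_le_one (α := ℝ)))
  have h2 := ((shift_integrable _ 1).2 h1).mul_const (Real.exp 1)
  refine h2.congr (ae_of_all _ fun t => ?_)
  have : Real.exp (-t) = Real.exp (-(t + 1)) * Real.exp 1 := by
    rw [← Real.exp_add]; ring_nf
  simp only [this]
  rw [show α + 2 - 1 = α + 1 by ring]
  ring

lemma upper_bern (α : ℝ) (hα : 0 ≤ α) (s : ℝ) (hs : 0 ≤ s) :
    (1 + s) ^ α ≤ 1 + α * s * (1 + s) ^ α := by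
  have h1 : 1 - α * s ≤ (1 + s) ^ (-α) := by
    rw [Real.rpow_def_of_pos (by linarith)]
    have h2 := Real.add_one_le_exp (Real.log (1 + s) * -α)
    have h3 := Real.log_le_sub_one_of_pos (show 0 < 1 + s by linarith)
    nlinarith
  have hp : 0 < (1 + s) ^ α := Real.rpow_pos_of_pos (by linarith) _
  rw [Real.rpow_neg (by linarith)] at h1
  have := mul_le_mul_of_nonneg_right h1 hp.le
  rw [inv_mul_cancel₀ hp.ne'] at this
  linarith

lemma lower_bern (α : ℝ) (hα : 0 ≤ α) (s : ℝ) (hs : 0 ≤ s) (hs1 : s ≤ 1) :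
    1 - (α + 1) * s ≤ (1 - s) ^ α := by
  have h1 := one_add_mul_self_le_rpow_one_add (s := -s) (by linarith) (p := α + 1) (by linarith)
  rw [← sub_eq_add_neg] at h1
  have h2 : (1 - s) ^ (α + 1) ≤ (1 - s) ^ α :=
    Real.rpow_le_rpow_of_exponent_ge_of_imp (by linarith) (by linarith) (by linarith)
      (by intro _ h; linarith)
  linarith

lemma key (α : ℝ) (hα : 0 ≤ α) (z : ℝ) (hz : 1 ≤ z) (t : ℝ) (ht : 0 < t) (b : ℝ)
    (hb : (t ≤ z ∧ b = (z - t) ^ α) ∨ (z < t ∧ b = 0)) :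
    0 ≤ (t + z) ^ α - b ∧
    (t + z) ^ α - b ≤ (2 * α + 1) * z ^ (α - 1) * (t + 1) ^ (α + 1) := by
  have hz0 : 0 < z := by linarith
  have hs : 0 ≤ t / z := by positivity
  have e1 : (t + z) ^ α = z ^ α * (1 + t / z) ^ α := by
    rw [← Real.mul_rpow hz0.le (by positivity)]
    congr 1; field_simp; ring
  have hzp : 0 < z ^ α := Real.rpow_pos_of_pos hz0 _
  have hlow : z ^ α * (1 - (α + 1) * (t / z)) ≤ b := by
    rcases hb with ⟨h, rfl⟩ | ⟨h, rfl⟩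
    · have h1 : t / z ≤ 1 := (div_le_one hz0).2 h
      have e2 : (z - t) ^ α = z ^ α * (1 - t / z) ^ α := by
        rw [← Real.mul_rpow hz0.le (by linarith)]
        congr 1; field_simp
      rw [e2]
      exact mul_le_mul_of_nonneg_left (lower_bern α hα _ hs h1) hzp.le
    · have h1 : 1 ≤ t / z := (one_le_div hz0).2 h.le
      apply mul_nonpos_of_nonneg_of_nonpos hzp.le
      nlinarith
  constructor
  · rcases hb with ⟨h, rfl⟩ | ⟨h, rfl⟩
    · have := Real.rpow_le_rpow (by linarith) (show z - t ≤ t + z by linarith) hα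
      linarith
    · have : 0 ≤ (t + z) ^ α := by positivity
      linarith
  · have hu := upper_bern α hα _ hs
    have h1 : (1:ℝ) ≤ (1 + t / z) ^ α := Real.one_le_rpow (by linarith) hα
    have hsz : t / z ≤ t := div_le_self ht.le hz
    have h2 : (1 + t / z) ^ α ≤ (t + 1) ^ α :=
      Real.rpow_le_rpow (by linarith) (by linarith) hα
    have e3 : z ^ (α - 1) = z ^ α / z := Real.rpow_sub_one hz0.ne' α
    have e4 : (t + 1) ^ (α + 1) = (t + 1) ^ α * (t + 1) := Real.rpow_add_one (by linarith) α
    have hA : (t + z) ^ α - b ≤ z ^ α * ((2 * α + 1) * (t / z) * (1 + t / z) ^ α) := by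
      rw [e1]
      have h5 : (1 + t / z) ^ α - (1 - (α + 1) * (t / z)) ≤
          (2 * α + 1) * (t / z) * (1 + t / z) ^ α := by
        have : (α + 1) * (t / z) * 1 ≤ (α + 1) * (t / z) * (1 + t / z) ^ α := by gcongr
        linarith
      have := mul_le_mul_of_nonneg_left h5 hzp.le
      linarith
    refine hA.trans ?_
    rw [e3, e4]
    calc z ^ α * ((2 * α + 1) * (t / z) * (1 + t / z) ^ α)
        = (2 * α + 1) * (z ^ α / z) * ((1 + t / z) ^ α * t) := by ring
      _ ≤ (2 * α + 1) * (z ^ α / z) * ((t + 1) ^ α * (t + 1)) := by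
        gcongr
        linarith

lemma h_le (t : ℝ) : 1 / (1 + Real.exp t) ≤ Real.exp (-t) := by
  rw [Real.exp_neg, ← one_div]
  exact one_div_le_one_div_of_le (Real.exp_pos _) (by linarith)

lemma main_bound (α : ℝ) (hα : 0 ≤ α) (z : ℝ) (hz : 1 ≤ z) :
    |fermi α z - z ^ (α + 1) / (α + 1)| ≤
      ((2 * α + 1) * ∫ t in Ioi (0:ℝ), (t + 1) ^ (α + 1) * Real.exp (-t)) * z ^ (α - 1) := by
  have hz0 : 0 < z := by linarith
  have hG := G_integrable α hα
  set F : ℝ → ℝ := fun x => x ^ α / (1 + Real.exp (x - z)) with hF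
  have hrc : Continuous fun x : ℝ => x ^ α := Real.continuous_rpow_const hα
  have hFc : Continuous F :=
    hrc.div (by fun_prop) (fun x => by positivity)
  have hpt : ∀ t : ℝ, F (t + z) = (t + z) ^ α * (1 / (1 + Real.exp t)) := by
    intro t; simp only [hF, add_sub_cancel_right]; ring
  set B : ℝ → ℝ := fun t => (z - t) ^ α * (1 / (1 + Real.exp t)) with hB
  have hBc : Continuous B := by
    refine (hrc.comp (continuous_const.sub continuous_id)).mul ?_
    exact continuous_const.div (by fun_prop) (fun x => by positivity)
  -- pointwise bound
  have hbd : ∀ t ∈ Ioi (0:ℝ), ‖F (t + z) - (Ioc 0 z).indicator B t‖ ≤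
      (2 * α + 1) * z ^ (α - 1) * ((t + 1) ^ (α + 1) * Real.exp (-t)) := by
    intro t ht
    have ht : 0 < t := ht
    have hh : 0 < 1 / (1 + Real.exp t) := by positivity
    obtain ⟨b, hb, hbe⟩ : ∃ b, ((t ≤ z ∧ b = (z - t) ^ α) ∨ (z < t ∧ b = 0)) ∧
        (Ioc 0 z).indicator B t = b * (1 / (1 + Real.exp t)) := by
      rcases le_or_gt t z with h | h
      · exact ⟨_, Or.inl ⟨h, rfl⟩, by rw [indicator_of_mem (show t ∈ Ioc 0 z from ⟨ht, h⟩)]⟩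
      · exact ⟨_, Or.inr ⟨h, rfl⟩, by
          rw [indicator_of_notMem (fun h' => absurd h'.2 (not_le.2 h)), zero_mul]⟩
    obtain ⟨k1, k2⟩ := key α hα z hz t ht b hb
    rw [hpt, hbe, ← sub_mul, Real.norm_of_nonneg (mul_nonneg k1 hh.le), ← mul_assoc]
    exact mul_le_mul k2 (h_le t) hh.le (k1.trans k2)
  have hBint : IntegrableOn B (Ioc 0 z) :=
    (hBc.integrableOn_Icc).mono_set Ioc_subset_Icc_self
  have hBind : IntegrableOn ((Ioc 0 z).indicator B) (Ioi 0) :=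
    ((integrable_indicator_iff measurableSet_Ioc).2 hBint).integrableOn
  have hdiff : IntegrableOn (fun t => F (t + z) - (Ioc 0 z).indicator B t) (Ioi 0) := by
    refine Integrable.mono' (hG.const_mul ((2 * α + 1) * z ^ (α - 1))) ?_ ?_
    · exact ((hFc.comp (continuous_id.add continuous_const)).aestronglyMeasurable).sub
        hBind.aestronglyMeasurable
    · exact (ae_restrict_iff' measurableSet_Ioi).2 (ae_of_all _ hbd)
  have hFs : IntegrableOn (fun t => F (t + z)) (Ioi 0) := by
    refine (Integrable.add hdiff hBind).congr (ae_of_all _ fun t => ?_)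
    simp
  have hFz : IntegrableOn F (Ioi z) := (shift_integrable F z).1 hFs
  have hF0 : IntegrableOn F (Ioc 0 z) := (hFc.integrableOn_Icc).mono_set Ioc_subset_Icc_self
  have s1 : fermi α z = (∫ x in (0:ℝ)..z, F x) + ∫ t in Ioi 0, F (t + z) := by
    rw [shift_integral, intervalIntegral.integral_of_le hz0.le, fermi,
      ← Ioc_union_Ioi_eq_Ioi hz0.le,
      setIntegral_union (Ioc_disjoint_Ioi le_rfl) measurableSet_Ioi hF0 hFz]
  have s2 : (∫ x in (0:ℝ)..z, x ^ α) = z ^ (α + 1) / (α + 1) := by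
    rw [integral_rpow (Or.inl (by linarith)), Real.zero_rpow (by linarith), sub_zero]
  have s3 : (∫ x in (0:ℝ)..z, x ^ α) - (∫ x in (0:ℝ)..z, F x) = ∫ x in (0:ℝ)..z, B x := by
    rw [← intervalIntegral.integral_sub (hrc.intervalIntegrable _ _)
      (hFc.intervalIntegrable _ _)]
    have := intervalIntegral.integral_comp_sub_left (a := 0) (b := z) B z
    rw [sub_self, sub_zero] at this
    rw [← this]
    congr 1
    ext x
    simp only [hF, hB, sub_sub_cancel]
    have e : Real.exp (z - x) = (Real.exp (x - z))⁻¹ := by rw [← Real.exp_neg]; ring_nf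
    rw [e]
    have := Real.exp_pos (x - z)
    field_simp
    ring
  have s4 : (∫ x in (0:ℝ)..z, B x) = ∫ t in Ioi 0, (Ioc 0 z).indicator B t := by
    rw [setIntegral_indicator measurableSet_Ioc, intervalIntegral.integral_of_le hz0.le,
      inter_eq_self_of_subset_right (fun x hx => hx.1)]
  have s5 : fermi α z - z ^ (α + 1) / (α + 1) =
      ∫ t in Ioi 0, (F (t + z) - (Ioc 0 z).indicator B t) := by
    rw [integral_sub hFs hBind, ← s4, ← s3, s2, s1]; ring
  rw [s5, ← Real.norm_eq_abs]
  refine (norm_integral_le_of_norm_le (hG.const_mul ((2 * α + 1) * z ^ (α - 1)))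
    ((ae_restrict_iff' measurableSet_Ioi).2 (ae_of_all _ hbd))).trans (le_of_eq ?_)
  rw [integral_const_mul]
  ring

theorem fermi_asymptotics (α : ℝ) (hα : 0 ≤ α) :
    ∃ C > (0:ℝ), ∃ z₀ > (0:ℝ), ∀ z ≥ z₀,
      |fermi α z - z ^ (α + 1) / (α + 1)| ≤ C * z ^ (α - 1) := by
  have hI : 0 ≤ ∫ t in Ioi (0:ℝ), (t + 1) ^ (α + 1) * Real.exp (-t) := by
    refine setIntegral_nonneg measurableSet_Ioi fun t ht => ?_
    have ht : 0 < t := ht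
    positivity
  refine ⟨(2 * α + 1) * (∫ t in Ioi (0:ℝ), (t + 1) ^ (α + 1) * Real.exp (-t)) + 1,
    by positivity, 1, one_pos, fun z hz => (main_bound α hα z hz).trans ?_⟩
  have hz : 1 ≤ z := hz
  gcongr
  linarith
end

section
/- For every real α > −1, the limit as z → +∞ of z^(−α)·( z·f_α(z) − ((α+2)/(α+1))·f_{α+1}(z) ) equals −π²/3. -/
open Set MeasureTheory Filter Real

/-- Minus the derivative of the Fermi factor. -/
noncomputable def fg (t : ℝ) : ℝ := Real.exp t / (1 + Real.exp t) ^ 2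

lemma fg_nonneg (t : ℝ) : 0 ≤ fg t := by unfold fg; positivity

lemma fg_cont : Continuous fg := by
  unfold fg
  refine Continuous.div (by fun_prop) (by fun_prop) (fun t => by positivity)

lemma fg_neg (t : ℝ) : fg (-t) = fg t := by
  unfold fg
  rw [Real.exp_neg]
  have := Real.exp_pos t
  field_simp
  ring

lemma fg_le (t : ℝ) : fg t ≤ Real.exp (-t) := by
  unfold fg
  rw [Real.exp_neg]
  have := Real.exp_pos t
  rw [div_le_iff₀ (by positivity), inv_mul_eq_div, le_div_iff₀ this]
  nlinarith

lemma fg_abs (t : ℝ) : fg |t| = fg t := by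
  rcases abs_choice t with h | h <;> rw [h]
  exact fg_neg t

lemma fg_le_abs (t : ℝ) : fg t ≤ Real.exp (-|t|) := by
  rw [← fg_abs]; exact fg_le _

lemma int_Ioi_rpow_exp (s : ℝ) (hs : -1 < s) :
    IntegrableOn (fun x : ℝ => x ^ s * Real.exp (-x)) (Ioi 0) := by
  have := Real.GammaIntegral_convergent (s := s + 1) (by linarith)
  refine this.congr_fun (fun x _ => ?_) measurableSet_Ioi
  simp [mul_comm]

lemma int_abs_rpow_exp (s : ℝ) (hs : -1 < s) :
    Integrable (fun x : ℝ => |x| ^ s * Real.exp (-|x|)) := by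
  apply Integrable.of_integral_ne_zero
  rw [integral_comp_abs (f := fun x : ℝ => x ^ s * Real.exp (-x))]
  have h := Real.integral_rpow_mul_exp_neg_mul_Ioi (a := s + 1) (r := 1) (by linarith) one_pos
  simp only [add_sub_cancel_right, one_mul] at h
  rw [h]
  have := Real.Gamma_pos_of_pos (s := s + 1) (by linarith)
  simp [this.ne']

lemma hasSum_eta_two :
    HasSum (fun n : ℕ => (-1 : ℝ) ^ n / (n : ℝ) ^ 2) (-(π ^ 2 / 12)) := by
  have h := hasSum_zeta_two
  have he : HasSum (fun n : ℕ => (1 : ℝ) / ((2 * n : ℕ) : ℝ) ^ 2) (π ^ 2 / 24) := by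
    convert! h.mul_left (1 / 4) using 1
    · ext n
      push_cast
      rw [mul_pow, ← div_div, ← mul_one_div]
      norm_num
    · ring
  have hs : Summable (fun n : ℕ => (1 : ℝ) / ((2 * n + 1 : ℕ) : ℝ) ^ 2) :=
    h.summable.comp_injective (i := fun n : ℕ => 2 * n + 1) (fun a b hab => by simpa using hab)
  have ho := (he.even_add_odd (f := fun n : ℕ => (1 : ℝ) / (n : ℝ) ^ 2) hs.hasSum).unique h
  have key := HasSum.even_add_odd (f := fun n : ℕ => (-1 : ℝ) ^ n / (n : ℝ) ^ 2)
    (m := π ^ 2 / 24) (m' := -(∑' n : ℕ, (1 : ℝ) / ((2 * n + 1 : ℕ) : ℝ) ^ 2))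
    (by simpa [pow_mul] using he)
    (by
      convert! hs.hasSum.neg using 1
      ext n
      simp [pow_succ, pow_mul, neg_div])
  convert! key using 1
  linarith

lemma int_sq_exp (n : ℕ) :
    ∫ t in Ioi (0:ℝ), t ^ 2 * Real.exp (-(((n : ℝ) + 1) * t)) = 2 / ((n : ℝ) + 1) ^ 3 := by
  have h := Real.integral_rpow_mul_exp_neg_mul_Ioi (a := 3) (r := (n : ℝ) + 1) (by norm_num)
    (by positivity)
  have h2 : Real.Gamma 3 = 2 := by simp [Nat.factorial]
  rw [h2] at h
  norm_num at h
  rw [h]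
  ring

lemma fg_int_Ioi : ∫ t in Ioi (0:ℝ), t ^ 2 * fg t = π ^ 2 / 6 := by
  let F : ℕ → ℝ → ℝ := fun n t => (-1 : ℝ) ^ n * ((n : ℝ) + 1) *
    (t ^ 2 * Real.exp (-(((n : ℝ) + 1) * t)))
  have hint : ∀ n, IntegrableOn (F n) (Ioi 0) := by
    intro n
    apply Integrable.const_mul
    apply Integrable.of_integral_ne_zero
    rw [int_sq_exp]
    positivity
  have hval : ∀ n, ∫ t in Ioi (0:ℝ), F n t = (-1) ^ n * (2 / ((n : ℝ) + 1) ^ 2) := by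
    intro n
    simp only [F]
    rw [integral_const_mul, int_sq_exp]
    field_simp
  have hnorm : ∀ n, ∫ t in Ioi (0:ℝ), ‖F n t‖ = (2 / ((n : ℝ) + 1) ^ 2) := by
    intro n
    have : ∀ t, ‖F n t‖ = ((n : ℝ) + 1) * (t ^ 2 * Real.exp (-(((n : ℝ) + 1) * t))) := by
      intro t
      simp only [F, norm_mul, norm_pow, norm_neg, norm_one, one_pow, one_mul]
      rw [Real.norm_of_nonneg (by positivity : 0 ≤ (n : ℝ) + 1),
        Real.norm_of_nonneg (Real.exp_pos _).le, Real.norm_eq_abs, sq_abs]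
    simp only [this]
    rw [integral_const_mul, int_sq_exp]
    field_simp
  have hsum : Summable (fun n => ∫ t in Ioi (0:ℝ), ‖F n t‖) := by
    simp only [hnorm]
    have := ((summable_nat_add_iff 1).2 hasSum_zeta_two.summable).mul_left 2
    refine this.congr (fun n => ?_)
    push_cast
    ring
  have H := hasSum_integral_of_summable_integral_norm hint hsum
  have hF : ∫ t in Ioi (0:ℝ), (∑' n, F n t) = ∫ t in Ioi (0:ℝ), t ^ 2 * fg t := by
    refine setIntegral_congr_fun measurableSet_Ioi (fun t ht => ?_)
    have ht : 0 < t := ht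
    have hr : ‖-Real.exp (-t)‖ < 1 := by
      rw [norm_neg, Real.norm_of_nonneg (Real.exp_pos _).le, Real.exp_lt_one_iff]
      linarith
    have h1 := hasSum_coe_mul_geometric_of_norm_lt_one hr
    rw [← hasSum_nat_add_iff' 1] at h1
    have h2 := h1.mul_left (-t ^ 2)
    have h3 : HasSum (fun n => F n t) (t ^ 2 * fg t) := by
      convert! h2 using 1
      · ext n
        simp only [F]
        rw [neg_pow (Real.exp (-t)), ← Real.exp_nat_mul]
        push_cast
        rw [pow_succ]
        ring_nf
      · simp
        unfold fg
        rw [Real.exp_neg]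
        have := Real.exp_pos t
        field_simp
        ring
    exact h3.tsum_eq
  rw [hF] at H
  simp only [hval] at H
  have h4 := hasSum_eta_two
  rw [← hasSum_nat_add_iff' 1] at h4
  have h5 := h4.mul_left (-2)
  refine H.unique ?_
  convert! h5 using 1
  · ext n
    push_cast
    ring
  · simp
    ring

lemma fg_int : ∫ t, t ^ 2 * fg t = π ^ 2 / 3 := by
  have := integral_comp_abs (f := fun t => t ^ 2 * fg t)
  simp only [sq_abs, fg_abs] at this
  rw [this, fg_int_Ioi]
  ring

lemma int_fermi (a z : ℝ) (ha : -1 < a) :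
    IntegrableOn (fun x : ℝ => x ^ a / (1 + Real.exp (x - z))) (Ioi 0) := by
  refine ((int_Ioi_rpow_exp a ha).mul_const (Real.exp z)).mono' ?_ ?_
  · exact Measurable.aestronglyMeasurable (by fun_prop)
  · refine (ae_restrict_iff' measurableSet_Ioi).2 (ae_of_all _ fun x hx => ?_)
    have hx : 0 < x := hx
    rw [Real.norm_of_nonneg (by positivity), mul_assoc, ← Real.exp_add, div_eq_mul_inv]
    gcongr
    rw [show -x + z = -(x - z) by ring, Real.exp_neg]
    gcongr
    linarith

lemma int_fg (b z : ℝ) (hb : -1 < b) :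
    IntegrableOn (fun x : ℝ => x ^ b * fg (x - z)) (Ioi 0) := by
  refine ((int_Ioi_rpow_exp b hb).mul_const (Real.exp z)).mono' ?_ ?_
  · have := fg_cont.measurable
    exact Measurable.aestronglyMeasurable (by fun_prop)
  · refine (ae_restrict_iff' measurableSet_Ioi).2 (ae_of_all _ fun x hx => ?_)
    have hx : 0 < x := hx
    have := fg_nonneg (x - z)
    rw [Real.norm_of_nonneg (by positivity), mul_assoc, ← Real.exp_add]
    gcongr
    rw [show -x + z = -(x - z) by ring]
    exact fg_le _

lemma fermi_parts (a z : ℝ) (ha : -1 < a) :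
    (a + 1) * fermi a z = ∫ x in Ioi (0:ℝ), x ^ (a + 1) * fg (x - z) := by
  have h := integral_Ioi_of_hasDerivAt_of_tendsto (a := 0) (m := 0)
    (f := fun x : ℝ => x ^ (a + 1) / (1 + Real.exp (x - z)))
    (f' := fun x : ℝ => (a + 1) * (x ^ a / (1 + Real.exp (x - z))) - x ^ (a + 1) * fg (x - z))
    ?_ ?_ ?_ ?_
  · rw [integral_sub ((int_fermi a z ha).const_mul _) (int_fg _ z (by linarith)),
      integral_const_mul, Real.zero_rpow (by linarith)] at h
    simp only [zero_div, sub_zero] at h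
    unfold fermi
    linarith
  · apply ContinuousAt.continuousWithinAt
    refine ContinuousAt.div ?_ (by fun_prop) (by positivity)
    exact Real.continuousAt_rpow_const _ _ (Or.inr (by linarith))
  · intro x hx
    have hx : 0 < x := hx
    have h1 : HasDerivAt (fun x : ℝ => x ^ (a + 1)) ((a + 1) * x ^ a) x := by
      have := Real.hasDerivAt_rpow_const (x := x) (p := a + 1) (Or.inl hx.ne')
      simpa using this
    have h2 : HasDerivAt (fun x : ℝ => 1 + Real.exp (x - z)) (Real.exp (x - z)) x := by
      have := (((hasDerivAt_id x).sub_const z).exp).const_add 1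
      simpa using this
    convert! h1.div h2 (by positivity) using 1
    unfold fg
    have := Real.exp_pos (x - z)
    field_simp
  · exact ((int_fermi a z ha).const_mul _).sub (int_fg _ z (by linarith))
  · have h0 := (tendsto_rpow_mul_exp_neg_mul_atTop_nhds_zero (a + 1) 1 one_pos).mul_const
      (Real.exp z)
    rw [zero_mul] at h0
    refine squeeze_zero' ?_ ?_ h0
    · filter_upwards [eventually_gt_atTop 0] with x hx
      positivity
    · filter_upwards [eventually_gt_atTop 0] with x hx
      rw [mul_assoc, ← Real.exp_add, div_eq_mul_inv]
      gcongr
      rw [show -1 * x + z = -(x - z) by ring, Real.exp_neg]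
      gcongr
      linarith

/-- The whole-line form of the combination. -/
lemma fermi_comb (a z : ℝ) (ha : -1 < a) :
    z * fermi a z - ((a + 2) / (a + 1)) * fermi (a + 1) z =
      -(1 / (a + 1)) * ∫ t, (max 0 (t + z)) ^ (a + 1) * (t * fg t) := by
  have h1 := fermi_parts a z ha
  have h2 := fermi_parts (a + 1) z (by linarith)
  have ha' : 0 < a + 1 := by linarith
  have i1 := int_fg (a + 1) z (by linarith)
  have i2 := int_fg (a + 1 + 1) z (by linarith)
  have e1 : ∫ t, (max 0 (t + z)) ^ (a + 1) * (t * fg t) =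
      ∫ x in Ioi (0:ℝ), (x ^ (a + 1 + 1) * fg (x - z) - z * (x ^ (a + 1) * fg (x - z))) := by
    rw [← integral_indicator measurableSet_Ioi]
    rw [← integral_add_right_eq_self (indicator _ _) z]
    congr 1
    ext t
    by_cases ht : 0 < t + z
    · rw [indicator_of_mem (show t + z ∈ Ioi (0:ℝ) from ht), max_eq_right ht.le,
        Real.rpow_add_one ht.ne' (a + 1), add_sub_cancel_right]
      ring
    · rw [indicator_of_notMem (show t + z ∉ Ioi (0:ℝ) from ht), max_eq_left (not_lt.1 ht),
        Real.zero_rpow ha'.ne', zero_mul]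
  rw [e1, integral_sub i2 (i1.const_mul _), integral_const_mul, ← h1, ← h2]
  field_simp
  ring

lemma pow_bound (b : ℝ) (hb : 0 < b) (u : ℝ) :
    |(max 0 (1 + u)) ^ b - 1| ≤ (1 + b) * |u| * (1 + |u|) ^ b := by
  have h1 : 1 ≤ (1 + |u|) ^ b := Real.one_le_rpow (by linarith [abs_nonneg u]) hb.le
  have hu := abs_nonneg u
  suffices h : |(max 0 (1 + u)) ^ b - 1| ≤ (1 + b) * |u| ∨
      |(max 0 (1 + u)) ^ b - 1| ≤ b * |u| * (1 + |u|) ^ b by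
    rcases h with h | h
    · exact h.trans (le_mul_of_one_le_right (by positivity) h1)
    · refine h.trans ?_
      gcongr
      linarith
  rcases le_total (1 + u) 0 with h | h
  · left
    rw [max_eq_left h, Real.zero_rpow hb.ne', abs_of_nonpos (by linarith : u ≤ 0)]
    norm_num
    nlinarith
  rw [max_eq_right h]
  rcases le_total u 0 with h0 | h0
  · left
    have hle : (1 + u) ^ b ≤ 1 := Real.rpow_le_one h (by linarith) hb.le
    rw [abs_of_nonpos (by linarith), abs_of_nonpos h0]
    rcases le_total 1 b with hb1 | hb1
    · have := one_add_mul_self_le_rpow_one_add (by linarith : -1 ≤ u) hb1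
      nlinarith
    · have : (1 + u) ^ (1:ℝ) ≤ (1 + u) ^ b :=
        Real.rpow_le_rpow_of_exponent_ge_of_imp h (by linarith) hb1 (fun _ h => by linarith)
      rw [Real.rpow_one] at this
      nlinarith
  · right
    have hy : 0 < 1 + u := by linarith
    rw [abs_of_nonneg h0, abs_of_nonneg (by linarith [Real.one_le_rpow (by linarith : 1 ≤ 1 + u) hb.le])]
    have hl := Real.log_le_sub_one_of_pos hy
    have h2 := Real.add_one_le_exp (-(b * Real.log (1 + u)))
    have h3 : (1 + u) ^ b * Real.exp (-(b * Real.log (1 + u))) = 1 := by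
      rw [Real.rpow_def_of_pos hy, ← Real.exp_add]
      simp [mul_comm]
    have h4 : 0 < (1 + u) ^ b := by positivity
    have h5 : 1 - b * u ≤ Real.exp (-(b * Real.log (1 + u))) := by nlinarith
    nlinarith [mul_le_mul_of_nonneg_left h5 h4.le]

lemma pow_bound2 (b : ℝ) (hb : 0 < b) (t : ℝ) (ht : 0 ≤ t) :
    (1 + t) ^ b ≤ 2 ^ b * (1 + t ^ b) := by
  have h2 : (0:ℝ) < 2 ^ b := by positivity
  have h3 : 0 ≤ t ^ b := by positivity
  rcases le_total t 1 with h | h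
  · have : (1 + t) ^ b ≤ 2 ^ b := by gcongr; linarith
    nlinarith
  · have : (1 + t) ^ b ≤ (2 * t) ^ b := by gcongr; linarith
    rw [Real.mul_rpow (by norm_num) ht] at this
    nlinarith

lemma int_t_fg : ∫ t, t * fg t = 0 := by
  have h := integral_neg_eq_self (fun t : ℝ => t * fg t) volume
  simp only [fg_neg, neg_mul, integral_neg] at h
  linarith

/-- The dominating function. -/
noncomputable def fdom (b t : ℝ) : ℝ :=
  (1 + b) * 2 ^ b * (|t| ^ (2:ℝ) * Real.exp (-|t|) + |t| ^ (b + 2) * Real.exp (-|t|))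

lemma fdom_int (b : ℝ) (hb : 0 < b) : Integrable (fdom b) :=
  ((int_abs_rpow_exp 2 (by norm_num)).add (int_abs_rpow_exp (b + 2) (by linarith))).const_mul _

lemma dom_bound (b : ℝ) (hb : 0 < b) (z : ℝ) (hz : 1 ≤ z) (t : ℝ) :
    ‖z * ((max 0 (1 + t / z)) ^ b - 1) * (t * fg t)‖ ≤ fdom b t := by
  have hz0 : 0 < z := by linarith
  have h1 := pow_bound b hb (t / z)
  have h2 := pow_bound2 b hb |t| (abs_nonneg t)
  have h3 : |t / z| ≤ |t| := by
    rw [abs_div, abs_of_pos hz0]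
    exact div_le_self (abs_nonneg t) hz
  have hg := fg_nonneg t
  rw [norm_mul, norm_mul, norm_mul, Real.norm_of_nonneg hz0.le, Real.norm_of_nonneg hg,
    Real.norm_eq_abs, Real.norm_eq_abs]
  have e1 : z * |t / z| = |t| := by
    rw [abs_div, abs_of_pos hz0]
    field_simp
  have e2 : |t| ^ (b + 2) = |t| ^ b * |t| ^ 2 := by
    rw [Real.rpow_add_of_nonneg (abs_nonneg t) hb.le (by norm_num)]
    norm_num
  calc z * |max 0 (1 + t / z) ^ b - 1| * (|t| * fg t)
      ≤ z * ((1 + b) * |t / z| * (1 + |t / z|) ^ b) * (|t| * Real.exp (-|t|)) := by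
        gcongr
        exact fg_le_abs t
    _ = (1 + b) * (z * |t / z|) * (1 + |t / z|) ^ b * (|t| * Real.exp (-|t|)) := by ring
    _ = (1 + b) * |t| * (1 + |t / z|) ^ b * (|t| * Real.exp (-|t|)) := by rw [e1]
    _ ≤ (1 + b) * |t| * (2 ^ b * (1 + |t| ^ b)) * (|t| * Real.exp (-|t|)) := by
        gcongr
        exact le_trans (by gcongr) h2
    _ = fdom b t := by
        unfold fdom
        rw [e2, Real.rpow_two]
        ring

lemma pt_lim (b : ℝ) (t : ℝ) :
    Tendsto (fun z : ℝ => z * ((max 0 (1 + t / z)) ^ b - 1)) atTop (nhds (b * t)) := by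
  have hd : HasDerivAt (fun u : ℝ => (1 + t * u) ^ b) (b * t) 0 := by
    have h1 : HasDerivAt (fun u : ℝ => 1 + t * u) t 0 := by
      simpa using ((hasDerivAt_id (0:ℝ)).const_mul t).const_add 1
    have := h1.rpow_const (p := b) (Or.inl (by simp))
    convert! this using 1
    simp [mul_comm]
  have h := hd.tendsto_slope_zero_right.comp tendsto_inv_atTop_nhdsGT_zero
  refine h.congr' ?_
  have h0 : Tendsto (fun z : ℝ => 1 + t / z) atTop (nhds (1 + 0)) :=
    (tendsto_const_nhds.div_atTop tendsto_id).const_add 1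
  rw [add_zero] at h0
  filter_upwards [h0.eventually (lt_mem_nhds zero_lt_one)] with z hz
  rw [max_eq_right hz.le]
  simp [div_eq_mul_inv]

lemma main_lim (b : ℝ) (hb : 0 < b) :
    Tendsto (fun z : ℝ => ∫ t, z * ((max 0 (1 + t / z)) ^ b - 1) * (t * fg t)) atTop
      (nhds (b * (π ^ 2 / 3))) := by
  have h : ∫ t, b * t * (t * fg t) = b * (π ^ 2 / 3) := by
    rw [← fg_int, ← integral_const_mul]
    congr 1
    ext t
    ring
  rw [← h]
  refine tendsto_integral_filter_of_dominated_convergence (fdom b) ?_ ?_ (fdom_int b hb) ?_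
  · have := fg_cont.measurable
    exact Eventually.of_forall fun z => Measurable.aestronglyMeasurable (by fun_prop)
  · filter_upwards [eventually_ge_atTop 1] with z hz
    exact ae_of_all _ (dom_bound b hb z hz)
  · exact ae_of_all _ fun t => (pt_lim b t).mul_const _

lemma int_t_fg' : Integrable (fun t => t * fg t) := by
  refine (int_abs_rpow_exp 1 (by norm_num)).mono' ?_ (ae_of_all _ fun t => ?_)
  · have := fg_cont
    exact Continuous.aestronglyMeasurable (by fun_prop)
  · rw [norm_mul, Real.norm_of_nonneg (fg_nonneg t), Real.norm_eq_abs, Real.rpow_one]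
    gcongr
    exact fg_le_abs t

theorem fermi_second_asymptotics (α : ℝ) (hα : -1 < α) :
    Tendsto
      (fun z : ℝ =>
        z ^ (-α) * (z * fermi α z - ((α + 2) / (α + 1)) * fermi (α + 1) z))
      atTop (nhds (-(Real.pi ^ 2) / 3)) := by
  have hb : 0 < α + 1 := by linarith
  have h := (main_lim (α + 1) hb).const_mul (-(1 / (α + 1)))
  have e : -(1 / (α + 1)) * ((α + 1) * (π ^ 2 / 3)) = -(Real.pi ^ 2) / 3 := by
    field_simp
  rw [e] at h
  refine h.congr' ?_
  filter_upwards [eventually_ge_atTop 1] with z hz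
  have hz0 : 0 < z := by linarith
  rw [fermi_comb α z hα, mul_left_comm]
  congr 1
  have hi : Integrable (fun t => z * ((max 0 (1 + t / z)) ^ (α + 1) - 1) * (t * fg t)) := by
    have := fg_cont.measurable
    exact (fdom_int (α + 1) hb).mono' (Measurable.aestronglyMeasurable (by fun_prop))
      (ae_of_all _ (dom_bound (α + 1) hb z hz))
  have e3 : ∫ t, z * (t * fg t) = 0 := by rw [integral_const_mul, int_t_fg, mul_zero]
  have e5 := integral_add hi (int_t_fg'.const_mul z)
  rw [e3, add_zero] at e5
  rw [← integral_const_mul, ← e5]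
  congr 1
  ext t
  have e4 : max 0 (t + z) = z * max 0 (1 + t / z) := by
    rw [mul_max_of_nonneg _ _ hz0.le, mul_zero]
    congr 1
    field_simp
    ring
  rw [e4, Real.mul_rpow hz0.le (le_max_left _ _), Real.rpow_add_one hz0.ne', Real.rpow_neg hz0.le]
  have : 0 < z ^ α := by positivity
  field_simp
  ring
end

section
/- Let α, β be real numbers with −1 < β < α. Then the composition g = f_α ∘ f_β^(−1), defined on (0,∞) (where f_β^(−1) : (0,∞) → ℝ is the inverse of the strictly increasing bijection f_β : ℝ → (0,∞)), is strictly increasing and convex on (0,∞). -/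
open Set MeasureTheory Function

theorem fermi_aux_isub {f g : ℝ → ℝ} (hf : IntegrableOn f (Set.Ioi 0))
    (hg : IntegrableOn g (Set.Ioi 0)) : IntegrableOn (fun x => f x - g x) (Set.Ioi 0) :=
  Integrable.sub hf hg

theorem fermi_aux_imul {f : ℝ → ℝ} (hf : IntegrableOn f (Set.Ioi 0)) (c : ℝ) :
    IntegrableOn (fun x => c * f x) (Set.Ioi 0) :=
  Integrable.const_mul hf c

theorem fermi_aux_integrable (α : ℝ) (hα : -1 < α) (z : ℝ) :
    IntegrableOn (fun x : ℝ => x ^ α / (1 + Real.exp (x - z))) (Set.Ioi 0) := by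
  have h1 := (Real.GammaIntegral_convergent (s := α + 1) (by linarith)).const_mul (Real.exp z)
  refine Integrable.mono' h1 ?_ ?_
  · apply Measurable.aestronglyMeasurable
    fun_prop
  · refine (ae_restrict_mem measurableSet_Ioi).mono ?_
    intro x hx
    have hx0 : (0:ℝ) < x := hx
    have hp : 0 < x ^ α := Real.rpow_pos_of_pos hx0 _
    have he := Real.exp_pos (x - z)
    rw [Real.norm_of_nonneg (by positivity), add_sub_cancel_right, div_le_iff₀ (by positivity)]
    have e1 : Real.exp z * Real.exp (-x) * Real.exp (x - z) = 1 := by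
      rw [← Real.exp_add, ← Real.exp_add, Real.exp_eq_one_iff]; ring
    have e2 : 0 < Real.exp z * Real.exp (-x) := by positivity
    have : Real.exp z * (Real.exp (-x) * x ^ α) * (1 + Real.exp (x - z))
        = x ^ α * (Real.exp z * Real.exp (-x) + Real.exp z * Real.exp (-x) * Real.exp (x - z)) := by
      ring
    rw [this, e1]
    nlinarith [mul_pos hp e2]

theorem fermi_aux_le_s8 (α : ℝ) (hα : -1 < α) (z : ℝ) :
    fermi α z ≤ Real.exp z * Real.Gamma (α + 1) := by
  have h1 := (Real.GammaIntegral_convergent (s := α + 1) (by linarith)).const_mul (Real.exp z)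
  rw [Real.Gamma_eq_integral (by linarith), ← integral_const_mul]
  refine setIntegral_mono_on (fermi_aux_integrable α hα z) h1 measurableSet_Ioi ?_
  intro x hx
  have hx0 : (0:ℝ) < x := hx
  have hp : 0 < x ^ α := Real.rpow_pos_of_pos hx0 _
  have he := Real.exp_pos (x - z)
  rw [add_sub_cancel_right, div_le_iff₀ (by positivity)]
  have e1 : Real.exp z * Real.exp (-x) * Real.exp (x - z) = 1 := by
    rw [← Real.exp_add, ← Real.exp_add, Real.exp_eq_one_iff]; ring
  have e2 : 0 < Real.exp z * Real.exp (-x) := by positivity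
  have : Real.exp z * (Real.exp (-x) * x ^ α) * (1 + Real.exp (x - z))
      = x ^ α * (Real.exp z * Real.exp (-x) + Real.exp z * Real.exp (-x) * Real.exp (x - z)) := by
    ring
  rw [this, e1]
  nlinarith [mul_pos hp e2]

theorem fermi_aux_ge (α : ℝ) (hα : -1 < α) (z : ℝ) (hz : 0 ≤ z) :
    z ^ (α + 1) / (2 * (α + 1)) ≤ fermi α z := by
  have hi := fermi_aux_integrable α hα z
  have hsub : Ioc 0 z ⊆ Ioi (0:ℝ) := fun x hx => hx.1
  have h1 : ∫ x in Ioc 0 z, x ^ α / (1 + Real.exp (x - z)) ≤ fermi α z := by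
    refine setIntegral_mono_set hi ?_ hsub.eventuallyLE
    refine (ae_restrict_mem measurableSet_Ioi).mono ?_
    intro x hx
    have hx0 : (0:ℝ) < x := hx
    have hp : 0 < x ^ α := Real.rpow_pos_of_pos hx0 _
    show 0 ≤ x ^ α / (1 + Real.exp (x - z))
    positivity
  have h2 : ∫ x in Ioc 0 z, x ^ α / 2 ≤ ∫ x in Ioc 0 z, x ^ α / (1 + Real.exp (x - z)) := by
    refine setIntegral_mono_on ?_ (hi.mono_set hsub) measurableSet_Ioc ?_
    · have := (intervalIntegral.intervalIntegrable_rpow' (a := 0) (b := z) hα).div_const 2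
      rwa [intervalIntegrable_iff_integrableOn_Ioc_of_le hz] at this
    · intro x hx
      have hp : 0 < x ^ α := Real.rpow_pos_of_pos hx.1 _
      have : Real.exp (x - z) ≤ 1 := Real.exp_le_one_iff.2 (by linarith [hx.2])
      have he := Real.exp_pos (x - z)
      gcongr
      linarith
  refine le_trans (le_of_eq ?_) (h2.trans h1)
  rw [← intervalIntegral.integral_of_le hz, intervalIntegral.integral_div,
    integral_rpow (Or.inl hα), Real.zero_rpow (by linarith)]
  have : α + 1 ≠ 0 := by linarith
  field_simp
  ring

theorem fermi_aux_strictMono (α : ℝ) (hα : -1 < α) : StrictMono (fermi α) := by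
  intro z w hzw
  have hz := fermi_aux_integrable α hα z
  have hw := fermi_aux_integrable α hα w
  have hpos : ∀ x ∈ Ioi (0:ℝ), 0 < x ^ α / (1 + Real.exp (x - w)) - x ^ α / (1 + Real.exp (x - z)) := by
    intro x hx
    have hx0 : (0:ℝ) < x := hx
    have hp : 0 < x ^ α := Real.rpow_pos_of_pos hx0 _
    have : Real.exp (x - w) < Real.exp (x - z) := Real.exp_lt_exp.2 (by linarith)
    have he := Real.exp_pos (x - w)
    rw [sub_pos]
    gcongr
  rw [← sub_pos]
  unfold fermi
  rw [← integral_sub hw hz]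
  rw [setIntegral_pos_iff_support_of_nonneg_ae _ (fermi_aux_isub hw hz)]
  · rw [inter_eq_self_of_subset_right]
    · simp
    · intro x hx
      exact (hpos x hx).ne'
  · exact (ae_restrict_mem measurableSet_Ioi).mono fun x hx => (hpos x hx).le

theorem fermi_aux_continuous (α : ℝ) (hα : -1 < α) : Continuous (fermi α) := by
  rw [continuous_iff_continuousAt]
  intro z
  refine continuousAt_of_dominated (bound := fun x : ℝ => x ^ α / (1 + Real.exp (x - (z + 1))))
    ?_ ?_ (fermi_aux_integrable α hα (z+1)) ?_
  · refine Filter.Eventually.of_forall fun w => (fermi_aux_integrable α hα w).1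
  · filter_upwards [Iio_mem_nhds (show z < z + 1 by linarith)] with w hw
    refine (ae_restrict_mem measurableSet_Ioi).mono ?_
    intro x hx
    have hx0 : (0:ℝ) < x := hx
    have hp : 0 < x ^ α := Real.rpow_pos_of_pos hx0 _
    have hw' : w < z + 1 := hw
    rw [Real.norm_of_nonneg (by positivity)]
    gcongr
  · refine Filter.Eventually.of_forall fun x => ?_
    refine Continuous.continuousAt ?_
    refine Continuous.div (by fun_prop) (by fun_prop) ?_
    intro w
    positivity

theorem fermi_aux_surj (α : ℝ) (hα : -1 < α) (y : ℝ) (hy : 0 < y) : ∃ z, fermi α z = y := by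
  have hG : 0 < Real.Gamma (α + 1) := Real.Gamma_pos_of_pos (by linarith)
  have h1 : fermi α (Real.log (y / Real.Gamma (α + 1))) ≤ y := by
    refine (fermi_aux_le_s8 α hα _).trans (le_of_eq ?_)
    rw [Real.exp_log (by positivity)]
    field_simp
  have ha : 0 < α + 1 := by linarith
  have h2 : y ≤ fermi α ((y * (2 * (α + 1))) ^ (α + 1)⁻¹) := by
    refine le_trans (le_of_eq ?_) (fermi_aux_ge α hα _ (by positivity))
    rw [Real.rpow_inv_rpow (by positivity) ha.ne']
    field_simp
  exact mem_range_of_exists_le_of_exists_ge (fermi_aux_continuous α hα) ⟨_, h1⟩ ⟨_, h2⟩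

theorem fermi_aux_slope (α β : ℝ) (hβ : -1 < β) (hβα : β < α) (z₁ z₂ z₃ : ℝ)
    (h12 : z₁ < z₂) (h23 : z₂ < z₃) :
    (fermi α z₂ - fermi α z₁) * (fermi β z₃ - fermi β z₂) ≤
      (fermi α z₃ - fermi α z₂) * (fermi β z₂ - fermi β z₁) := by
  have hα : -1 < α := by linarith
  have pA := sub_pos.2 (fermi_aux_strictMono α hα h12)
  have pB := sub_pos.2 (fermi_aux_strictMono β hβ h12)
  obtain ⟨m, hm⟩ : ∃ m, m = (fermi α z₂ - fermi α z₁) / (fermi β z₂ - fermi β z₁) := ⟨_, rfl⟩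
  have hm0 : 0 < m := hm ▸ div_pos pA pB
  have hmeq : fermi α z₂ - fermi α z₁ = m * (fermi β z₂ - fermi β z₁) := by
    rw [hm]; field_simp
  have hγ : 0 < α - β := by linarith
  obtain ⟨x₀, hx₀⟩ : ∃ x₀, x₀ = m ^ (α - β)⁻¹ := ⟨_, rfl⟩
  have hx₀p : 0 < x₀ := hx₀ ▸ Real.rpow_pos_of_pos hm0 _
  have hx₀m : x₀ ^ (α - β) = m := by rw [hx₀, Real.rpow_inv_rpow hm0.le hγ.ne']
  let K : ℝ → ℝ → ℝ := fun z x => 1 / (1 + Real.exp (x - z))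
  obtain ⟨r, hr⟩ : ∃ r, r = (K z₃ x₀ - K z₂ x₀) / (K z₂ x₀ - K z₁ x₀) := ⟨_, rfl⟩
  have key : ∀ x ∈ Ioi (0:ℝ),
      0 ≤ (x ^ α - m * x ^ β) * ((K z₃ x - K z₂ x) - r * (K z₂ x - K z₁ x)) := by
    intro x hx
    have hx0 : (0:ℝ) < x := hx
    have hp : 0 < x ^ β := Real.rpow_pos_of_pos hx0 _
    have e1 : x ^ α - m * x ^ β = x ^ β * (x ^ (α - β) - x₀ ^ (α - β)) := by
      rw [hx₀m, mul_sub, ← Real.rpow_add hx0]; ring_nf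
    obtain ⟨a, ha⟩ : ∃ a, a = Real.exp (-z₁) := ⟨_, rfl⟩
    obtain ⟨b, hb⟩ : ∃ b, b = Real.exp (-z₂) := ⟨_, rfl⟩
    obtain ⟨c, hc⟩ : ∃ c, c = Real.exp (-z₃) := ⟨_, rfl⟩
    obtain ⟨t, ht⟩ : ∃ t, t = Real.exp x := ⟨_, rfl⟩
    obtain ⟨s, hs⟩ : ∃ s, s = Real.exp x₀ := ⟨_, rfl⟩
    have pa : 0 < a := ha ▸ Real.exp_pos _
    have pb : 0 < b := hb ▸ Real.exp_pos _
    have pc : 0 < c := hc ▸ Real.exp_pos _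
    have pt : 0 < t := ht ▸ Real.exp_pos _
    have ps : 0 < s := hs ▸ Real.exp_pos _
    have hba : 0 < a - b := by rw [ha, hb, sub_pos]; exact Real.exp_lt_exp.2 (by linarith)
    have hcb : 0 < b - c := by rw [hc, hb, sub_pos]; exact Real.exp_lt_exp.2 (by linarith)
    have e2 : (K z₃ x - K z₂ x) - r * (K z₂ x - K z₁ x)
        = (t - s) * (t * (b - c) * (a - c) / ((1 + t * a) * (1 + t * b) * (1 + t * c) * (1 + s * c))) := by
      have hr' : r = (b - c) * (1 + s * a) / ((a - b) * (1 + s * c)) := by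
        rw [hr]
        simp only [K, sub_eq_add_neg x₀, Real.exp_add, ← ha, ← hb, ← hc, ← hs]
        have d1 : 1 / (1 + s * c) - 1 / (1 + s * b) = s * (b - c) / ((1 + s * c) * (1 + s * b)) := by
          field_simp; ring
        have d2 : 1 / (1 + s * b) - 1 / (1 + s * a) = s * (a - b) / ((1 + s * b) * (1 + s * a)) := by
          field_simp; ring
        rw [d1, d2]
        field_simp
      rw [hr']
      simp only [K, sub_eq_add_neg x, Real.exp_add, ← ha, ← hb, ← hc, ← ht]
      have d1 : 1 / (1 + t * c) - 1 / (1 + t * b) = t * (b - c) / ((1 + t * c) * (1 + t * b)) := by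
        field_simp; ring
      have d2 : 1 / (1 + t * b) - 1 / (1 + t * a) = t * (a - b) / ((1 + t * b) * (1 + t * a)) := by
        field_simp; ring
      rw [d1, d2]
      field_simp
      ring
    have hac : 0 < a - c := by linarith
    have hq : 0 ≤ t * (b - c) * (a - c) / ((1 + t * a) * (1 + t * b) * (1 + t * c) * (1 + s * c)) := by
      positivity
    rw [e1, e2]
    rcases le_total x₀ x with h | h
    · have h1 : 0 ≤ x ^ (α - β) - x₀ ^ (α - β) :=
        sub_nonneg.2 (Real.rpow_le_rpow hx₀p.le h hγ.le)
      have h2 : 0 ≤ t - s := by rw [ht, hs, sub_nonneg]; exact Real.exp_le_exp.2 h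
      positivity
    · have h1 : x ^ (α - β) - x₀ ^ (α - β) ≤ 0 :=
        sub_nonpos.2 (Real.rpow_le_rpow hx0.le h hγ.le)
      have h2 : t - s ≤ 0 := by rw [ht, hs, sub_nonpos]; exact Real.exp_le_exp.2 h
      exact mul_nonneg_of_nonpos_of_nonpos (mul_nonpos_of_nonneg_of_nonpos hp.le h1)
        (mul_nonpos_of_nonpos_of_nonneg h2 hq)
  have hnonneg := setIntegral_nonneg (μ := volume) measurableSet_Ioi key
  have iα := fermi_aux_integrable α hα
  have iβ := fermi_aux_integrable β hβ
  have heq : ∫ x in Ioi (0:ℝ), (x ^ α - m * x ^ β) * ((K z₃ x - K z₂ x) - r * (K z₂ x - K z₁ x))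
      = ((fermi α z₃ - fermi α z₂) - r * (fermi α z₂ - fermi α z₁))
        - m * ((fermi β z₃ - fermi β z₂) - r * (fermi β z₂ - fermi β z₁)) := by
    unfold fermi
    have j1 := fermi_aux_isub (iα z₃) (iα z₂)
    have j2 := fermi_aux_isub (iα z₂) (iα z₁)
    have j3 := fermi_aux_isub (iβ z₃) (iβ z₂)
    have j4 := fermi_aux_isub (iβ z₂) (iβ z₁)
    have j5 := fermi_aux_imul j2 r
    have j6 := fermi_aux_imul j4 r
    have j7 := fermi_aux_isub j1 j5
    have j8 := fermi_aux_imul (fermi_aux_isub j3 j6) m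
    rw [← integral_sub (iα z₃) (iα z₂), ← integral_sub (iα z₂) (iα z₁),
      ← integral_sub (iβ z₃) (iβ z₂), ← integral_sub (iβ z₂) (iβ z₁),
      ← integral_const_mul, ← integral_const_mul,
      ← integral_sub j1 j5, ← integral_sub j3 j6,
      ← integral_const_mul, ← integral_sub j7 j8]
    congr 1
    funext x
    simp only [K]
    ring
  rw [heq] at hnonneg
  have h3 : m * (fermi β z₃ - fermi β z₂) ≤ fermi α z₃ - fermi α z₂ := by
    rw [hmeq] at hnonneg
    linarith
  rw [hmeq]
  calc _ = m * (fermi β z₃ - fermi β z₂) * (fermi β z₂ - fermi β z₁) := by ring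
    _ ≤ _ := mul_le_mul_of_nonneg_right h3 pB.le

theorem fermi_comp_inv_strictMono_convex
    (α β : ℝ) (hβ : -1 < β) (hβα : β < α) :
    StrictMonoOn (fermi α ∘ Function.invFun (fermi β)) (Set.Ioi 0) ∧
    ConvexOn ℝ (Set.Ioi 0) (fermi α ∘ Function.invFun (fermi β)) := by
  have hα : -1 < α := by linarith
  have hinv : ∀ y ∈ Ioi (0:ℝ), fermi β (Function.invFun (fermi β) y) = y := fun y hy =>
    Function.invFun_eq (fermi_aux_surj β hβ y hy)
  have hmono : ∀ y ∈ Ioi (0:ℝ), ∀ w ∈ Ioi (0:ℝ), y < w →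
      Function.invFun (fermi β) y < Function.invFun (fermi β) w := by
    intro y hy w hw hyw
    rw [← (fermi_aux_strictMono β hβ).lt_iff_lt, hinv y hy, hinv w hw]
    exact hyw
  refine ⟨fun y hy w hw hyw => fermi_aux_strictMono α hα (hmono y hy w hw hyw), ?_⟩
  refine convexOn_of_slope_mono_adjacent (convex_Ioi 0) ?_
  intro x y z hx hz hxy hyz
  have hy : y ∈ Ioi (0:ℝ) := lt_trans hx hxy
  have := fermi_aux_slope α β hβ hβα _ _ _ (hmono x hx y hy hxy) (hmono y hy z hz hyz)
  rw [hinv x hx, hinv y hy, hinv z hz] at this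
  rw [div_le_div_iff₀ (by linarith) (by linarith)]
  exact this
end

section
/- Let d ≥ 2 be a real number and let P : (0,∞) → ℝ be twice differentiable. Suppose that the function z ↦ (d/dz)( P(z)·z^(−(1+2/d)) )·z^(1+2/d) has strictly positive derivative at every z > 0. Then for each fixed n > 0, the function ϑ ↦ ϑ^(d/2+1)·P(n·ϑ^(−d/2)) is convex on (0,∞). -/
open Set

theorem pressure_temperature_convex
    (d : ℝ) (hd : 2 ≤ d)
    (P P' P'' : ℝ → ℝ)
    (hP : ∀ z : ℝ, 0 < z → HasDerivAt P (P' z) z)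
    (hP' : ∀ z : ℝ, 0 < z → HasDerivAt P' (P'' z) z)
    (hpos : ∀ z : ℝ, 0 < z →
      0 < deriv (fun y : ℝ =>
        deriv (fun w : ℝ => P w * w ^ (-(1 + 2 / d))) y * y ^ (1 + 2 / d)) z)
    (n : ℝ) (hn : 0 < n) :
    ConvexOn ℝ (Set.Ioi 0)
      (fun ϑ : ℝ => ϑ ^ (d / 2 + 1) * P (n * ϑ ^ (-(d / 2)))) := by
  have hd0 : 0 < d := by linarith
  set G : ℝ → ℝ := fun y : ℝ =>
        deriv (fun w : ℝ => P w * w ^ (-(1 + 2 / d))) y * y ^ (1 + 2 / d) with hG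
  have hGmono : StrictMonoOn G (Ioi 0) := by
    apply strictMonoOn_of_deriv_pos (convex_Ioi 0)
    · intro z hz
      exact (differentiableAt_of_deriv_ne_zero (hpos z hz).ne').continuousAt.continuousWithinAt
    · intro z hz
      rw [interior_Ioi] at hz
      exact hpos z hz
  have hGval : ∀ y : ℝ, 0 < y → G y = P' y - (1 + 2 / d) * P y / y := by
    intro y hy
    have h1 := ((hP y hy).mul (Real.hasDerivAt_rpow_const (p := -(1 + 2 / d)) (Or.inl hy.ne'))).deriv
    have h2 : G y = (P' y * y ^ (-(1 + 2 / d)) +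
        P y * (-(1 + 2 / d) * y ^ (-(1 + 2 / d) - 1))) * y ^ (1 + 2 / d) := by
      rw [← h1]; rfl
    rw [h2, Real.rpow_sub_one hy.ne', Real.rpow_neg hy.le]
    have := (Real.rpow_pos_of_pos hy (1 + 2 / d)).ne'
    generalize y ^ (1 + 2 / d) = t at *
    field_simp
    ring
  have hF : ∀ x : ℝ, 0 < x → HasDerivAt (fun ϑ : ℝ => ϑ ^ (d / 2 + 1) * P (n * ϑ ^ (-(d / 2))))
      (-(d / 2 * n) * G (n * x ^ (-(d / 2)))) x := by
    intro x hx
    have hz : 0 < n * x ^ (-(d / 2)) := mul_pos hn (Real.rpow_pos_of_pos hx _)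
    have h1 : HasDerivAt (fun ϑ : ℝ => n * ϑ ^ (-(d / 2))) _ x :=
      (Real.hasDerivAt_rpow_const (p := -(d / 2)) (Or.inl hx.ne')).const_mul n
    have h2 := (hP _ hz).comp x h1
    have h3 := (Real.hasDerivAt_rpow_const (p := d / 2 + 1) (Or.inl hx.ne')).mul h2
    refine h3.congr_deriv ?_
    rw [hGval _ hz]
    simp only [Function.comp_apply]
    rw [Real.rpow_sub_one hx.ne', Real.rpow_sub_one hx.ne', Real.rpow_add_one hx.ne']
    generalize P' (n * x ^ (-(d / 2))) = p'
    generalize P (n * x ^ (-(d / 2))) = p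
    rw [Real.rpow_neg hx.le]
    have := (Real.rpow_pos_of_pos hx (d / 2)).ne'
    generalize x ^ (d / 2) = t at *
    field_simp
    ring
  apply MonotoneOn.convexOn_of_deriv (convex_Ioi 0)
  · intro x hx
    exact (hF x hx).continuousAt.continuousWithinAt
  · rw [interior_Ioi]
    intro x hx
    exact (hF x hx).differentiableAt.differentiableWithinAt
  · rw [interior_Ioi]
    intro x hx y hy hxy
    rw [(hF x hx).deriv, (hF y hy).deriv]
    have hx' : 0 < n * x ^ (-(d / 2)) := mul_pos hn (Real.rpow_pos_of_pos hx _)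
    have hy' : 0 < n * y ^ (-(d / 2)) := mul_pos hn (Real.rpow_pos_of_pos hy _)
    have h : n * y ^ (-(d / 2)) ≤ n * x ^ (-(d / 2)) :=
      mul_le_mul_of_nonneg_left
        (Real.rpow_le_rpow_of_nonpos hx hxy (by linarith)) hn.le
    have h2 := hGmono.monotoneOn hy' hx' h
    have h3 : 0 ≤ d / 2 * n := by positivity
    exact mul_le_mul_of_nonpos_left h2 (by linarith)
end

section
/- Let d be an integer with 2 < d ≤ 4 and let Ω ⊂ ℝ^d be a bounded measurable set. There exists a constant C > 0, depending only on d and Ω, with the following property: for every measurable function n : ℝ^d → ℝ with n ≥ 0, n vanishing outside Ω, ∫ n dx = M < ∞ and ∫ n^(1+2/d) dx < ∞, and for every smooth compactly supported function φ : ℝ^d → ℝ with support contained in Ω, one has |∫ n·φ dx| ≤ C·M^(1/2 − 1/d)·( ∫ n^(1+2/d) dx + ∫ |∇φ|² dx ). -/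
open Set MeasureTheory

theorem potential_energy_estimate
    (d : ℕ) (hd2 : 2 < d) (hd4 : d ≤ 4)
    (Ω : Set (EuclideanSpace ℝ (Fin d)))
    (hΩb : Bornology.IsBounded Ω) (hΩm : MeasurableSet Ω) :
    ∃ C : ℝ, 0 < C ∧
      ∀ (n : EuclideanSpace ℝ (Fin d) → ℝ) (M : ℝ),
        (∀ x, 0 ≤ n x) →
        (∀ x ∉ Ω, n x = 0) →
        Measurable n →
        Integrable n →
        (∫ x, n x) = M →
        Integrable (fun x => n x ^ (1 + 2 / (d : ℝ))) →
        ∀ φ : EuclideanSpace ℝ (Fin d) → ℝ,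
          ContDiff ℝ (⊤ : ℕ∞) φ →
          HasCompactSupport φ →
          tsupport φ ⊆ Ω →
          |∫ x, n x * φ x| ≤
            C * M ^ ((1:ℝ) / 2 - 1 / (d : ℝ)) *
              ((∫ x, n x ^ (1 + 2 / (d : ℝ))) + ∫ x, ‖fderiv ℝ φ x‖ ^ 2) := by
  have hd0 : (0:ℝ) < d := by positivity
  have hd2' : (2:ℝ) < d := by exact_mod_cast hd2
  have hd4' : (d:ℝ) ≤ 4 := by exact_mod_cast hd4
  have he0 : (0:ℝ) ≤ 1 / 2 - 1 / (d:ℝ) := by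
    have : 1 / (d:ℝ) ≤ 1 / 2 := one_div_le_one_div_of_le (by norm_num) hd2'.le
    linarith
  have he4 : (1:ℝ) / 4 ≤ 1 / (d:ℝ) := one_div_le_one_div_of_le hd0 hd4'
  obtain ⟨K, hK⟩ : ∃ K : NNReal, ∀ φ : EuclideanSpace ℝ (Fin d) → ℝ,
      ContDiff ℝ (⊤ : ℕ∞) φ → tsupport φ ⊆ Ω →
      eLpNorm φ ((d : NNReal) : ENNReal) volume ≤
        K * eLpNorm (fderiv ℝ φ) ((2 : NNReal) : ENNReal) volume := by
    refine ⟨eLpNormLESNormFDerivOfLeConst ℝ (volume : Measure (EuclideanSpace ℝ (Fin d)))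
      Ω 2 (d : NNReal), fun φ h1 h2 => ?_⟩
    refine eLpNorm_le_eLpNorm_fderiv_of_le volume (h1.of_le (by simp)) 
      ((subset_tsupport φ).trans h2) (by norm_num) ?_ ?_ hΩb
    · simpa using mod_cast hd2
    · simp only [finrank_euclideanSpace, Fintype.card_fin]
      push_cast
      rw [inv_eq_one_div, inv_eq_one_div]
      linarith
  refine ⟨K + 1, by positivity, ?_⟩
  intro n M hn0 _ hnm hni hM hqi φ hφ hφc hφs
  set A := ∫ x, n x ^ (1 + 2 / (d : ℝ)) with hA
  set B := ∫ x, ‖fderiv ℝ φ x‖ ^ 2 with hB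
  have hM0 : 0 ≤ M := hM ▸ integral_nonneg hn0
  have hA0 : 0 ≤ A := integral_nonneg fun x => Real.rpow_nonneg (hn0 x) _
  have hB0 : 0 ≤ B := integral_nonneg fun x => by positivity
  have hφcont : Continuous φ := hφ.continuous
  have hdc : Continuous (fderiv ℝ φ) := hφ.continuous_fderiv (by simp)
  have hdi : Integrable (fun x => ‖fderiv ℝ φ x‖ ^ 2) := by
    apply Continuous.integrable_of_hasCompactSupport (by fun_prop)
    exact (hφc.fderiv ℝ).comp_left (g := fun y => ‖y‖ ^ 2) (by simp)
  have e1 : ∫⁻ x, ENNReal.ofReal (n x) = ENNReal.ofReal M := by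
    rw [← hM, ofReal_integral_eq_lintegral_ofReal hni (Filter.Eventually.of_forall hn0)]
  have e2 : ∫⁻ x, ENNReal.ofReal (n x ^ (1 + 2 / (d : ℝ))) = ENNReal.ofReal A := by
    rw [hA, ofReal_integral_eq_lintegral_ofReal hqi
      (Filter.Eventually.of_forall fun x => Real.rpow_nonneg (hn0 x) _)]
  have e3 : (∫⁻ x, ‖φ x‖ₑ ^ (d:ℝ)) ^ (1 / (d:ℝ)) ≤ ENNReal.ofReal (K * B ^ (1/2:ℝ)) := by
    have h := hK φ hφ hφs
    rw [eLpNorm_nnreal_eq_lintegral (by positivity), eLpNorm_nnreal_eq_lintegral (by norm_num)] at h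
    refine (le_of_eq (by simp)).trans (h.trans (le_of_eq ?_))
    rw [ENNReal.ofReal_mul (by positivity), ENNReal.ofReal_coe_nnreal,
      ← ENNReal.ofReal_rpow_of_nonneg hB0 (by norm_num), hB,
      ofReal_integral_eq_lintegral_ofReal hdi (Filter.Eventually.of_forall fun x => by positivity)]
    congr 2
    refine lintegral_congr fun x => ?_
    rw [ENNReal.ofReal_pow (norm_nonneg _), ofReal_norm]
    simp
  have key : ∫⁻ x, ‖n x * φ x‖ₑ ≤
      ENNReal.ofReal (M ^ ((1:ℝ) / 2 - 1 / (d : ℝ)) * (A ^ (1/2:ℝ) * (K * B ^ (1/2:ℝ)))) := by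
    have H := ENNReal.lintegral_prod_norm_pow_le
      (μ := (volume : Measure (EuclideanSpace ℝ (Fin d)))) (Finset.univ : Finset (Fin 3))
      (f := ![fun x => ENNReal.ofReal (n x), fun x => ENNReal.ofReal (n x ^ (1 + 2 / (d : ℝ))),
        fun x => ‖φ x‖ₑ ^ (d:ℝ)])
      (p := ![(1:ℝ) / 2 - 1 / (d : ℝ), 1/2, 1/(d:ℝ)])
      (by
        intro i _
        fin_cases i
        · exact hnm.ennreal_ofReal.aemeasurable
        · exact (hnm.pow_const _).ennreal_ofReal.aemeasurable
        · exact (hφcont.measurable.enorm.pow_const _).aemeasurable)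
      (by simp only [Fin.sum_univ_three, Matrix.cons_val]; ring)
      (by
        intro i _
        fin_cases i
        · exact he0
        · norm_num
        · simp)
    simp only [Fin.prod_univ_three, Matrix.cons_val] at H
    rw [e1, e2] at H
    refine (le_of_eq ?_).trans (H.trans ?_)
    · refine lintegral_congr fun x => ?_
      rw [enorm_mul, ← ENNReal.rpow_mul, mul_one_div_cancel hd0.ne', ENNReal.rpow_one,
        Real.enorm_of_nonneg (hn0 x),
        ENNReal.ofReal_rpow_of_nonneg (hn0 x) he0,
        ENNReal.ofReal_rpow_of_nonneg (Real.rpow_nonneg (hn0 x) _) (by norm_num),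
        ← ENNReal.ofReal_mul (Real.rpow_nonneg (hn0 x) _), ← Real.rpow_mul (hn0 x),
        ← Real.rpow_add_of_nonneg (hn0 x) he0 (by positivity)]
      have : (1:ℝ) / 2 - 1 / (d:ℝ) + (1 + 2 / (d:ℝ)) * (1 / 2) = 1 := by ring
      rw [this, Real.rpow_one]
    · rw [ENNReal.ofReal_mul (by positivity), ENNReal.ofReal_mul (by positivity), ← mul_assoc,
        ← ENNReal.ofReal_rpow_of_nonneg hM0 he0,
        ← ENNReal.ofReal_rpow_of_nonneg hA0 (by norm_num)]
      gcongr
  have h1 : |∫ x, n x * φ x| ≤ M ^ ((1:ℝ) / 2 - 1 / (d : ℝ)) * (A ^ (1/2:ℝ) * (K * B ^ (1/2:ℝ))) := by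
    rw [← ENNReal.ofReal_le_ofReal_iff (by positivity), ← Real.enorm_eq_ofReal_abs]
    exact (enorm_integral_le_lintegral_enorm _).trans key
  refine h1.trans ?_
  have hAM : A ^ (1/2:ℝ) * B ^ (1/2:ℝ) ≤ A + B := by
    rw [← Real.sqrt_eq_rpow, ← Real.sqrt_eq_rpow]
    nlinarith [Real.sq_sqrt hA0, Real.sq_sqrt hB0, sq_nonneg (√A - √B)]
  have hMp : 0 ≤ M ^ ((1:ℝ) / 2 - 1 / (d : ℝ)) := by positivity
  calc _ = K * M ^ ((1:ℝ) / 2 - 1 / (d : ℝ)) * (A ^ (1/2:ℝ) * B ^ (1/2:ℝ)) := by ring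
    _ ≤ (K + 1) * M ^ ((1:ℝ) / 2 - 1 / (d : ℝ)) * (A + B) := by
      gcongr
      linarith
end
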